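/- arXiv:2211.06357 — 4 statements merged into one kernel-verified Lean document; each statement's English description precedes it below -/
import Mathlib

section
/- Let G be a finite group, H ≤ G a subgroup, and V a finite-dimensional complex representation of H of even dimension whose determinant character is trivial. Then the determinant character of the induced representation Ind_H^G V is trivial. -/
open scoped BigOperators

noncomputable section

namespace Chars

/-- The permutation character `Ind_H^G 1` of `G` acting on the cosets `G ⧸ H`:
`g` is sent to the number of fixed points of `g` on `G ⧸ H`. -/
def permChar {G : Type} [Group G] (H : Subgroup G) : G → ℂ :=
  fun g => (Nat.card {x : G ⧸ H // g • x = x} : ℂ)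

open scoped Classical in
/-- The class function on `G` induced from a class function `f` on a subgroup `H`. -/
def indChar {G : Type} [Group G] [Finite G] (H : Subgroup G) (f : ↥H → ℂ) : G → ℂ :=
  fun g => (Nat.card ↥H : ℂ)⁻¹ *
    ∑ᶠ x : G, if h : x⁻¹ * g * x ∈ H then f ⟨x⁻¹ * g * x, h⟩ else 0

/-- The determinant character of a finite dimensional complex representation. -/
def detChar {G : Type} [Group G] (V : FDRep ℂ G) : G → ℂ :=
  fun g => LinearMap.det (V.ρ g)

/-- `χ` is a permutation (virtual) character: a `ℤ`-linear combination of the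
characters `Ind_H^G 1` of permutation representations. -/
def IsPermChar {G : Type} [Group G] (χ : G → ℂ) : Prop :=
  ∃ (k : ℕ) (Hs : Fin k → Subgroup G) (ns : Fin k → ℤ),
    χ = fun g => ∑ i, (ns i : ℂ) * permChar (Hs i) g

/-- `χ` is a virtual character: a difference of two genuine characters. -/
def IsVirtualChar {G : Type} [Group G] (χ : G → ℂ) : Prop :=
  ∃ V W : FDRep ℂ G, χ = V.character - W.character

/-- The virtual character `χ` has trivial determinant:  writing `χ = χ_V - χ_W`, the
determinant characters of `V` and `W` agree.  (The determinant of a virtual character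
is well defined, so this does not depend on the choice of decomposition.) -/
def HasTrivialDet {G : Type} [Group G] (χ : G → ℂ) : Prop :=
  ∃ V W : FDRep ℂ G, χ = V.character - W.character ∧ ∀ g, detChar V g = detChar W g

/-- The set `S_G` of permutation characters of `G` of degree `0` with trivial
determinant. -/
def MemS {G : Type} [Group G] (χ : G → ℂ) : Prop :=
  IsPermChar χ ∧ χ 1 = 0 ∧ HasTrivialDet χ

/-- The set `P_G`: the smallest set of (real valued) characters of `G` containing
`τ + τ̄` for every virtual character `τ` of degree `0`, containing
`Ind_H^G (τ - 1 - det τ)` for every subgroup `H ≤ G` and every degree `2` character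
`τ` of `H` factoring through a quotient of `H` isomorphic to `C₂ × C₂`, `D₈` or
`D_{2p}` (`p` an odd prime), and closed under `ℤ`-linear combinations. -/
inductive MemP (G : Type) [Group G] [Finite G] : (G → ℂ) → Prop where
  | selfConj (V W : FDRep ℂ G) (hdeg : V.character 1 = W.character 1) :
      MemP G ((V.character - W.character) + star (V.character - W.character))
  | dihedralInd (H : Subgroup G) (τ : FDRep ℂ ↥H) (hdeg : τ.character 1 = 2)
      (N : Subgroup ↥H) [hN : N.Normal]
      (hfac : ∀ n h : ↥H, n ∈ N → τ.character (n * h) = τ.character h)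
      (hquot : Nonempty (↥H ⧸ N ≃* Multiplicative (ZMod 2) × Multiplicative (ZMod 2)) ∨
               Nonempty (↥H ⧸ N ≃* DihedralGroup 4) ∨
               ∃ p : ℕ, p.Prime ∧ Odd p ∧ Nonempty (↥H ⧸ N ≃* DihedralGroup p)) :
      MemP G (indChar H (τ.character - 1 - detChar τ))
  | zero : MemP G 0
  | add {χ ψ : G → ℂ} : MemP G χ → MemP G ψ → MemP G (χ + ψ)
  | zsmul (n : ℤ) {χ : G → ℂ} : MemP G χ → MemP G (n • χ)

end Chars
open Chars

open Polynomial in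
/-- Over an algebraically closed field, `det (q f)` is the product of the values of `q` at the
roots of the characteristic polynomial of `f`. -/
theorem det_aeval_eq_prod_eval_roots_charpoly {K M : Type*} [Field K] [IsAlgClosed K]
    [AddCommGroup M] [Module K M] [FiniteDimensional K M] (f : Module.End K M) (q : K[X]) :
    LinearMap.det (aeval f q) = (f.charpoly.roots.map fun r => q.eval r).prod := by
  have hcard : f.charpoly.roots.card = Module.finrank K M := by
    rw [← (IsAlgClosed.splits f.charpoly).natDegree_eq_card_roots, LinearMap.charpoly_natDegree]
  have hq : q ∈ Submonoid.closure ({C a | a : K} ∪ {X + C a | a : K}) := IsAlgClosed.splits q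
  induction hq using Submonoid.closure_induction with
  | mem q hq =>
    rcases hq with ⟨a, rfl⟩ | ⟨a, rfl⟩
    · simp [Algebra.algebraMap_eq_smul_one, LinearMap.det_smul, hcard]
    · have hneg : aeval f (X + C a) = (-1 : K) • (algebraMap K (Module.End K M) (-a) - f) := by
        simp
      rw [hneg, LinearMap.det_smul, ← LinearMap.eval_charpoly,
        (IsAlgClosed.splits f.charpoly).eval_eq_prod_roots_of_monic f.charpoly_monic, ← hcard,
        ← Multiset.card_map (fun r => -a - r), ← Multiset.prod_map_neg, Multiset.map_map]
      refine congrArg Multiset.prod (Multiset.map_congr rfl fun r _ => ?_)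
      simp
  | one => simp
  | mul p q _ _ hp hq => simp [hp, hq, Multiset.prod_map_mul]

open Polynomial in
/-- Over an algebraically closed field, the trace of `f ^ k` is the `k`-th power sum of the
roots of the characteristic polynomial of `f`. -/
theorem trace_pow_eq_sum_roots_charpoly {K M : Type*} [Field K] [IsAlgClosed K]
    [AddCommGroup M] [Module K M] [FiniteDimensional K M] (f : Module.End K M) (k : ℕ) :
    LinearMap.trace K M (f ^ k) = (f.charpoly.roots.map fun r => r ^ k).sum := by
  have : Infinite K := IsAlgClosed.instInfinite
  have hpoly : (f ^ k).charpoly =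
      ((f.charpoly.roots.map fun r => r ^ k).map fun r => X - C r).prod := by
    refine Polynomial.funext fun t => ?_
    have h := det_aeval_eq_prod_eval_roots_charpoly f (C t - X ^ k)
    rw [LinearMap.eval_charpoly, Polynomial.eval_multiset_prod, Multiset.map_map,
      Multiset.map_map]
    simpa using h
  rw [Module.End.trace_eq_sum_roots_charpoly_of_splits (IsAlgClosed.splits _), hpoly,
    roots_multiset_prod_X_sub_C]

/-- In characteristic zero, a finite multiset is determined by its power sums. -/
theorem multiset_eq_of_power_sums_eq {K : Type*} [Field K] [CharZero K] {s t : Multiset K}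
    (h : ∀ k : ℕ, (s.map fun r => r ^ k).sum = (t.map fun r => r ^ k).sum) : s = t := by
  classical
  have hli : LinearIndependent K fun z : K => (powersHom K z : Multiplicative ℕ → K) :=
    (linearIndependent_monoidHom (Multiplicative ℕ) K).comp _ (powersHom K).injective
  set u := s.toFinset ∪ t.toFinset
  have hsum (m : Multiset K) (hm : m.toFinset ⊆ u) (k : ℕ) :
      (m.map fun r => r ^ k).sum = ∑ z ∈ u, (m.count z : K) * z ^ k := by
    rw [Finset.sum_multiset_map_count, Finset.sum_subset hm]
    · simp
    · intro z _ hz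
      simp [Multiset.count_eq_zero.2 fun h' => hz (Multiset.mem_toFinset.2 h')]
  have hzero := linearIndependent_iff'.1 hli u (fun z => (s.count z : K) - t.count z) (by
    ext k
    have hk := h k.toAdd
    rw [hsum s Finset.subset_union_left, hsum t Finset.subset_union_right] at hk
    simp [sub_mul, hk])
  ext z
  by_cases hz : z ∈ u
  · exact_mod_cast sub_eq_zero.1 (hzero z hz)
  · simp only [u, Finset.mem_union, Multiset.mem_toFinset, not_or] at hz
    rw [Multiset.count_eq_zero.2 hz.1, Multiset.count_eq_zero.2 hz.2]

/-- Endomorphisms whose powers have equal traces have equal determinants. -/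
theorem det_eq_det_of_trace_pow_eq {K M N : Type*} [Field K] [IsAlgClosed K] [CharZero K]
    [AddCommGroup M] [Module K M] [FiniteDimensional K M]
    [AddCommGroup N] [Module K N] [FiniteDimensional K N]
    {f : Module.End K M} {g : Module.End K N}
    (h : ∀ k : ℕ, LinearMap.trace K M (f ^ k) = LinearMap.trace K N (g ^ k)) :
    LinearMap.det f = LinearMap.det g := by
  rw [Module.End.det_eq_prod_roots_charpoly_of_splits (IsAlgClosed.splits _),
    Module.End.det_eq_prod_roots_charpoly_of_splits (IsAlgClosed.splits _)]
  refine congrArg Multiset.prod (multiset_eq_of_power_sums_eq fun k => ?_)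
  simpa only [trace_pow_eq_sum_roots_charpoly] using h k

/-- The trace of an endomorphism of `X → M` is the sum of the traces of its diagonal blocks. -/
theorem trace_eq_sum_trace_diagonal_blocks {R M X : Type*} [CommRing R] [AddCommGroup M]
    [Module R M] [Module.Free R M] [Module.Finite R M] [Fintype X] [DecidableEq X]
    (f : (X → M) →ₗ[R] X → M) :
    LinearMap.trace R (X → M) f = ∑ x, LinearMap.trace R M
      (LinearMap.proj x ∘ₗ f ∘ₗ LinearMap.single R (fun _ => M) x) := by
  have hf : f = ∑ x, (f ∘ₗ LinearMap.single R (fun _ => M) x) ∘ₗ LinearMap.proj x := by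
    refine LinearMap.ext fun v => ?_
    simp only [LinearMap.sum_apply, LinearMap.comp_apply, LinearMap.proj_apply, ← map_sum]
    exact congrArg f (LinearMap.sum_single_apply _ v).symm
  conv_lhs => rw [hf, map_sum]
  exact Finset.sum_congr rfl fun x _ => LinearMap.trace_comp_comm' _ _

/-- Permuting the coordinates of `X → M` has determinant one if `M` has even rank. -/
theorem det_funLeft_perm_of_even {R M X : Type*} [CommRing R] [Nontrivial R] [AddCommGroup M]
    [Module R M] [Module.Free R M] [Module.Finite R M] [Finite X]
    (hM : Even (Module.finrank R M)) (σ : Equiv.Perm X) :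
    LinearMap.det (LinearMap.funLeft R M σ) = 1 := by
  classical
  have := Fintype.ofFinite X
  let b := Module.finBasis R M
  let e : (X → M) ≃ₗ[R] (Fin (Module.finrank R M) → X → R) :=
    { toFun := fun f i x => b.equivFun (f x) i
      invFun := fun f x => b.equivFun.symm fun i => f i x
      map_add' := fun _ _ => by ext; simp
      map_smul' := fun _ _ => by ext; simp
      left_inv := fun f => by ext x; exact b.equivFun.symm_apply_apply (f x)
      right_inv := fun f => by
        ext i x; exact congrFun (b.equivFun.apply_symm_apply fun i => f i x) i }
  have hconj : (e : (X → M) →ₗ[R] _) ∘ₗ LinearMap.funLeft R M σ ∘ₗ e.symm.toLinearMap =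
      LinearMap.pi fun i => LinearMap.funLeft R R σ ∘ₗ LinearMap.proj i := by
    refine LinearMap.ext fun f => ?_
    obtain ⟨f, rfl⟩ := e.surjective f
    simp only [LinearMap.comp_apply, LinearEquiv.coe_coe, LinearEquiv.symm_apply_apply]
    rfl
  have hsign : LinearMap.det (LinearMap.funLeft R R σ) = (Equiv.Perm.sign σ : R) := by
    rw [← Matrix.det_permutation, ← LinearMap.det_toLin']
    congr 1
    refine LinearMap.ext fun f => ?_
    rw [Matrix.toLin'_apply, Matrix.permMatrix_mulVec]
    rfl
  rw [← LinearMap.det_conj _ e, hconj, LinearMap.det_pi, Finset.prod_const, Finset.card_univ,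
    Fintype.card_fin, hsign]
  rcases Int.units_eq_one_or (Equiv.Perm.sign σ) with h | h <;> simp [h, hM.neg_one_pow]

/-- The factor in `H` of the action of `g` on the coset `x`, with respect to the chosen
coset representatives. -/
def cosetCocycle {G : Type*} [Group G] (H : Subgroup G) (g : G) (x : G ⧸ H) : H :=
  ⟨x.out⁻¹ * g * (g⁻¹ • x).out, by
    rw [mul_assoc, ← QuotientGroup.eq, ← smul_eq_mul, ← MulAction.Quotient.smul_coe]
    simp⟩

theorem cosetCocycle_mul {G : Type*} [Group G] (H : Subgroup G) (g g' : G) (x : G ⧸ H) :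
    cosetCocycle H (g * g') x = cosetCocycle H g x * cosetCocycle H g' (g⁻¹ • x) := by
  ext
  simp [cosetCocycle, mul_assoc, mul_smul]

theorem cosetCocycle_one {G : Type*} [Group G] (H : Subgroup G) (x : G ⧸ H) :
    cosetCocycle H 1 x = 1 := by
  ext
  simp [cosetCocycle]

/-- The induced representation, realised on functions from the cosets to `V`. -/
def cosetRep {k G V : Type*} [CommRing k] [Group G] [AddCommGroup V] [Module k V]
    {H : Subgroup G} (ρ : Representation k H V) : Representation k G (G ⧸ H → V) where
  toFun g := LinearMap.pi fun x => ρ (cosetCocycle H g x) ∘ₗ LinearMap.proj (g⁻¹ • x)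
  map_one' := by
    refine LinearMap.ext fun f => funext fun x => ?_
    simp [cosetCocycle_one]
  map_mul' g g' := by
    refine LinearMap.ext fun f => funext fun x => ?_
    simp [cosetCocycle_mul, mul_smul]

theorem det_cosetRep_of_even {k G V : Type*} [CommRing k] [Nontrivial k] [Group G]
    [AddCommGroup V] [Module k V] [Module.Free k V] [Module.Finite k V] {H : Subgroup G}
    [Finite (G ⧸ H)] (ρ : Representation k H V) (heven : Even (Module.finrank k V))
    (hdet : ∀ h, LinearMap.det (ρ h) = 1) (g : G) : LinearMap.det (cosetRep ρ g) = 1 := by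
  classical
  have := Fintype.ofFinite (G ⧸ H)
  have hcomp : cosetRep ρ g =
      (LinearMap.pi fun x => ρ (cosetCocycle H g x) ∘ₗ LinearMap.proj x) ∘ₗ
        LinearMap.funLeft k V (MulAction.toPerm g⁻¹ : Equiv.Perm (G ⧸ H)) := rfl
  rw [hcomp, LinearMap.det_comp, LinearMap.det_pi, det_funLeft_perm_of_even heven]
  simp [hdet]

open scoped Classical in
theorem trace_cosetRep {k G V : Type*} [CommRing k] [Group G]
    [AddCommGroup V] [Module k V] [Module.Free k V] [Module.Finite k V] {H : Subgroup G}
    [Fintype (G ⧸ H)] (ρ : Representation k H V) (g : G) :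
    LinearMap.trace k _ (cosetRep ρ g) = ∑ x : G ⧸ H,
      if h : x.out⁻¹ * g * x.out ∈ H then LinearMap.trace k V (ρ ⟨_, h⟩) else 0 := by
  rw [trace_eq_sum_trace_diagonal_blocks]
  refine Finset.sum_congr rfl fun x _ => ?_
  have hfix : x.out⁻¹ * g * x.out ∈ H ↔ g⁻¹ • x = x := by
    rw [mul_assoc, ← QuotientGroup.eq, ← smul_eq_mul, ← MulAction.Quotient.smul_coe,
      QuotientGroup.out_eq', inv_smul_eq_iff, eq_comm]
  split_ifs with h
  · congr 1
    refine LinearMap.ext fun v => ?_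
    have hx := hfix.1 h
    have hc : cosetCocycle H g x = ⟨_, h⟩ := Subtype.ext (by simp [cosetCocycle, hx])
    simp [cosetRep, hx, hc]
  · rw [← map_zero (LinearMap.trace k V)]
    congr 1
    refine LinearMap.ext fun v => ?_
    simp [cosetRep, mt hfix.2 h]

open scoped Classical in
theorem trace_cosetRep_eq_indChar {G : Type} [Group G] [Finite G] {H : Subgroup G}
    (V : FDRep ℂ ↥H) (g : G) :
    LinearMap.trace ℂ _ (cosetRep V.ρ g) = indChar H V.character g := by
  have := Fintype.ofFinite G
  have := Fintype.ofFinite H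
  have := Fintype.ofFinite (G ⧸ H)
  let F : G → ℂ := fun x =>
    if h : x⁻¹ * g * x ∈ H then V.character ⟨x⁻¹ * g * x, h⟩ else 0
  have hF (x : G) (s : H) : F (x * s) = F x := by
    have hmem : (x * s : G)⁻¹ * g * (x * s) ∈ H ↔ x⁻¹ * g * x ∈ H := by
      rw [show (x * s : G)⁻¹ * g * (x * s) = (s : G)⁻¹ * (x⁻¹ * g * x) * s by group,
        H.mul_mem_cancel_right s.2, H.mul_mem_cancel_left (H.inv_mem s.2)]
    by_cases h : x⁻¹ * g * x ∈ H
    · simp only [F, dif_pos h, dif_pos (hmem.2 h)]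
      rw [← V.char_conj ⟨x⁻¹ * g * x, h⟩ s⁻¹]
      congr 1
      ext
      simp [mul_assoc]
    · simp only [F, dif_neg h, dif_neg (mt hmem.1 h)]
  let e : (G ⧸ H) × H ≃ G := Equiv.ofBijective (fun p => p.1.out * p.2) <| by
    constructor
    · rintro ⟨x, s⟩ ⟨y, t⟩ hst
      have hxy : x = y := by
        simpa using congrArg (QuotientGroup.mk : G → G ⧸ H) hst
      subst hxy
      simpa using hst
    · intro a
      exact ⟨(a, ⟨(a : G ⧸ H).out⁻¹ * a, QuotientGroup.eq.1 (QuotientGroup.out_eq' _)⟩),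
        by simp⟩
  have he (p : (G ⧸ H) × H) : e p = p.1.out * p.2 := rfl
  have hsum : ∑ x, F x = Nat.card H * ∑ x : G ⧸ H, F x.out := by
    rw [← e.sum_comp, Fintype.sum_prod_type, Finset.mul_sum]
    simp [he, hF]
  have hcard : (Nat.card H : ℂ) ≠ 0 := Nat.cast_ne_zero.2 Nat.card_pos.ne'
  rw [trace_cosetRep, indChar, finsum_eq_sum_of_fintype]
  exact (eq_inv_mul_iff_mul_eq₀ hcard).2 hsum.symm

/-- If `V` is a finite dimensional complex representation of `H ≤ G` of
even dimension with trivial determinant character, then the induced representation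
`Ind_H^G V` (i.e. any representation of `G` whose character is the induced character)
has trivial determinant character. -/
theorem det_of_induced_trivial (G : Type) [Group G] [Finite G] (H : Subgroup G)
    (V : FDRep ℂ ↥H)
    (heven : Even (Module.finrank ℂ V))
    (hdet : ∀ h : ↥H, detChar V h = 1) :
    ∀ W : FDRep ℂ G, W.character = indChar H V.character → ∀ g : G, detChar W g = 1 := by
  intro W hW g
  rw [← det_cosetRep_of_even V.ρ heven hdet g]
  refine det_eq_det_of_trace_pow_eq fun k => ?_
  rw [← map_pow, ← map_pow, trace_cosetRep_eq_indChar, ← hW]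
  rfl
end
end

section
/- Let G be a finite group and H ≤ G a subgroup. If ρ ∈ S_H, then Ind_H^G ρ ∈ S_G. -/
open scoped BigOperators

noncomputable section

open Chars

namespace Chars

section Induction

variable {G : Type} [Group G] (H : Subgroup G)

theorem out_inv_mul_mul_out_mem (g : G) (q : G ⧸ H) :
    q.out⁻¹ * g * (g⁻¹ • q).out ∈ H := by
  rw [mul_assoc, ← QuotientGroup.eq, QuotientGroup.out_eq', ← smul_eq_mul,
    ← MulAction.Quotient.smul_coe, QuotientGroup.out_eq', smul_inv_smul]

theorem out_conj_mem_iff (g : G) (q : G ⧸ H) :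
    q.out⁻¹ * g * q.out ∈ H ↔ g • q = q := by
  rw [mul_assoc, ← QuotientGroup.eq, QuotientGroup.out_eq', ← smul_eq_mul,
    ← MulAction.Quotient.smul_coe, QuotientGroup.out_eq', eq_comm]

/-- The factor in `H` by which `g` carries the chosen representative of `g⁻¹ • q` to that
of `q`. -/
def cosetFactor (g : G) (q : G ⧸ H) : H :=
  ⟨q.out⁻¹ * g * (g⁻¹ • q).out, out_inv_mul_mul_out_mem H g q⟩

theorem cosetFactor_mul (a b : G) (q : G ⧸ H) :
    cosetFactor H (a * b) q = cosetFactor H a q * cosetFactor H b (a⁻¹ • q) := by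
  apply Subtype.ext
  simp only [cosetFactor, Subgroup.coe_mul, mul_inv_rev, mul_smul]
  group

theorem cosetFactor_one (q : G ⧸ H) : cosetFactor H 1 q = 1 := by
  apply Subtype.ext
  simp [cosetFactor]

/-- The representation induced from `H`, realised on functions `G ⧸ H → V` by means of the chosen
coset representatives. -/
def indRep {V : Type} [AddCommGroup V] [Module ℂ V] (ρ : Representation ℂ H V) :
    Representation ℂ G (G ⧸ H → V) where
  toFun g := LinearMap.pi fun q => ρ (cosetFactor H g q) ∘ₗ LinearMap.proj (g⁻¹ • q)
  map_one' := by
    ext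
    simp [cosetFactor_one]
  map_mul' a b := by
    refine LinearMap.ext fun f => funext fun q => ?_
    simp [cosetFactor_mul, mul_smul]

theorem bijective_out_mul :
    Function.Bijective fun p : (G ⧸ H) × H => p.1.out * (p.2 : G) := by
  constructor
  · rintro ⟨q, h⟩ ⟨q', h'⟩ e
    have e : q.out * (h : G) = q'.out * (h' : G) := e
    have hq : q = q' := by
      have := congrArg (QuotientGroup.mk : G → G ⧸ H) e
      simpa [QuotientGroup.mk_mul_of_mem] using this
    subst hq
    simpa using e
  · intro x
    refine ⟨⟨(x : G ⧸ H), ⟨(x : G ⧸ H).out⁻¹ * x, ?_⟩⟩, by simp⟩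
    rw [← QuotientGroup.eq, QuotientGroup.out_eq']

open scoped Classical in
theorem indChar_eq_sum_quotient [Finite G] [Fintype (G ⧸ H)] (f : H → ℂ)
    (hf : ∀ h k : H, f (h⁻¹ * k * h) = f k) (g : G) :
    indChar H f g = ∑ q : G ⧸ H,
      if h : q.out⁻¹ * g * q.out ∈ H then f ⟨q.out⁻¹ * g * q.out, h⟩ else 0 := by
  have := Fintype.ofFinite G
  have hH : (Nat.card H : ℂ) ≠ 0 := Nat.cast_ne_zero.mpr Nat.card_pos.ne'
  rw [indChar, finsum_eq_sum_of_fintype, inv_mul_eq_iff_eq_mul₀ hH,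
    ← (bijective_out_mul H).sum_comp, Fintype.sum_prod_type, Finset.mul_sum]
  refine Finset.sum_congr rfl fun q _ => ?_
  rw [Nat.card_eq_fintype_card, ← nsmul_eq_mul, ← Finset.card_univ]
  refine Finset.sum_eq_card_nsmul fun h _ => ?_
  have key : (q.out * (h : G))⁻¹ * g * (q.out * h) =
      (h : G)⁻¹ * (q.out⁻¹ * g * q.out) * h := by group
  have hiff : (q.out * (h : G))⁻¹ * g * (q.out * h) ∈ H ↔ q.out⁻¹ * g * q.out ∈ H := by
    rw [key, Subgroup.mul_mem_cancel_right _ h.2,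
      Subgroup.mul_mem_cancel_left _ (inv_mem h.2)]
  by_cases hm : q.out⁻¹ * g * q.out ∈ H
  · rw [dif_pos hm, dif_pos (hiff.mpr hm), ← hf h ⟨_, hm⟩]
    congr 1
    exact Subtype.ext key
  · rw [dif_neg hm, dif_neg (mt hiff.mp hm)]

theorem trace_pi_comp_proj {ι V : Type*} [Fintype ι] [DecidableEq ι] [AddCommGroup V]
    [Module ℂ V] [FiniteDimensional ℂ V] (A : ι → V →ₗ[ℂ] V) (σ : ι → ι) :
    LinearMap.trace ℂ (ι → V) (LinearMap.pi fun i => A i ∘ₗ LinearMap.proj (σ i)) =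
      ∑ i, if σ i = i then LinearMap.trace ℂ V (A i) else 0 := by
  set T : (ι → V) →ₗ[ℂ] (ι → V) := LinearMap.pi fun i => A i ∘ₗ LinearMap.proj (σ i) with hT
  have hsum : T = ∑ i, LinearMap.single ℂ (fun _ => V) i ∘ₗ (LinearMap.proj i ∘ₗ T) := by
    refine LinearMap.ext fun f => funext fun j => ?_
    simp [LinearMap.sum_apply, Pi.single_apply]
  rw [hsum, map_sum]
  refine Finset.sum_congr rfl fun i _ => ?_
  rw [LinearMap.trace_comp_comm']
  split_ifs with h
  · congr 1
    ext v
    simp [hT, h]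
  · convert map_zero (LinearMap.trace ℂ V)
    ext v
    simp [hT, h]

theorem character_indRep [Finite G] (V : FDRep ℂ H) :
    (FDRep.of (indRep H V.ρ)).character = indChar H V.character := by
  classical
  have := Fintype.ofFinite (G ⧸ H)
  funext g
  rw [indChar_eq_sum_quotient H _ (fun h k => by simpa using V.char_conj k h⁻¹)]
  refine (trace_pi_comp_proj (fun q => V.ρ (cosetFactor H g q)) (g⁻¹ • ·)).trans
    (Finset.sum_congr rfl fun q _ => ?_)
  have hiff : q.out⁻¹ * g * q.out ∈ H ↔ g⁻¹ • q = q := by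
    rw [out_conj_mem_iff, inv_smul_eq_iff, eq_comm]
  by_cases hq : g⁻¹ • q = q
  · rw [if_pos hq, dif_pos (hiff.mpr hq)]
    change V.character _ = V.character _
    congr 1
    apply Subtype.ext
    simp only [cosetFactor, hq]
  · rw [if_neg hq, dif_neg (mt hiff.mp hq)]

theorem det_indRep [Fintype (G ⧸ H)] {V : Type} [AddCommGroup V] [Module ℂ V]
    [FiniteDimensional ℂ V] (ρ : Representation ℂ H V) (g : G) :
    LinearMap.det (indRep H ρ g) = (∏ q, LinearMap.det (ρ (cosetFactor H g q))) *
      LinearMap.det (LinearMap.funLeft ℂ V (g⁻¹ • · : G ⧸ H → G ⧸ H)) := by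
  rw [← LinearMap.det_pi, ← LinearMap.det_comp]
  rfl

theorem det_funLeft_eq_of_linearEquiv {ι V W : Type*} [AddCommGroup V] [Module ℂ V]
    [AddCommGroup W] [Module ℂ W] (e : V ≃ₗ[ℂ] W) (σ : ι → ι) :
    LinearMap.det (LinearMap.funLeft ℂ V σ) = LinearMap.det (LinearMap.funLeft ℂ W σ) := by
  rw [← LinearMap.det_conj (LinearMap.funLeft ℂ V σ) (LinearEquiv.piCongrRight fun _ => e)]
  congr 1
  refine LinearMap.ext fun f => funext fun i => ?_
  simp [LinearMap.funLeft_apply]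

theorem detChar_indRep_eq [Finite G] {V W : FDRep ℂ H}
    (hdeg : Module.finrank ℂ V = Module.finrank ℂ W)
    (hdet : ∀ h, detChar V h = detChar W h) (g : G) :
    detChar (FDRep.of (indRep H V.ρ)) g = detChar (FDRep.of (indRep H W.ρ)) g := by
  have := Fintype.ofFinite (G ⧸ H)
  change LinearMap.det (indRep H V.ρ g) = LinearMap.det (indRep H W.ρ g)
  rw [det_indRep, det_indRep,
    det_funLeft_eq_of_linearEquiv (LinearEquiv.ofFinrankEq V W hdeg)]
  exact congrArg (· * _) (Finset.prod_congr rfl fun q _ => hdet _)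

open scoped Classical in
theorem permChar_eq_sum [Fintype G] (g : G) :
    permChar H g = (Nat.card H : ℂ)⁻¹ * ∑ x : G, if x⁻¹ * g * x ∈ H then 1 else 0 := by
  have h := indChar_eq_sum_quotient H (fun _ => 1) (fun _ _ => rfl) g
  rw [indChar, finsum_eq_sum_of_fintype] at h
  simp only [dite_eq_ite] at h
  rw [h, permChar]
  simp [out_conj_mem_iff, Nat.card_eq_fintype_card, Fintype.card_subtype]

theorem indChar_permChar [Finite G] (K : Subgroup H) :
    indChar H (permChar K) = permChar (K.map H.subtype) := by
  classical
  have := Fintype.ofFinite G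
  funext g
  have hH : (Nat.card H : ℂ) ≠ 0 := Nat.cast_ne_zero.mpr Nat.card_pos.ne'
  have inner (x : G) :
      (if h : x⁻¹ * g * x ∈ H then permChar K ⟨x⁻¹ * g * x, h⟩ else 0) =
        (Nat.card K : ℂ)⁻¹ * ∑ y : H,
          if (x * (y : G))⁻¹ * g * (x * y) ∈ K.map H.subtype then 1 else 0 := by
    have key (y : H) : (x * (y : G))⁻¹ * g * (x * y) = (y : G)⁻¹ * (x⁻¹ * g * x) * y := by group
    split_ifs with h
    · rw [permChar_eq_sum]
      congr 1
      refine Finset.sum_congr rfl fun y _ => if_congr ?_ rfl rfl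
      rw [key, ← Subgroup.mem_map_iff_mem H.subtype_injective]
      rfl
    · symm
      convert mul_zero _
      refine Finset.sum_eq_zero fun y _ => if_neg fun hm => h ?_
      have := Subgroup.map_subtype_le K hm
      rwa [key, Subgroup.mul_mem_cancel_right _ y.2,
        Subgroup.mul_mem_cancel_left _ (inv_mem y.2)] at this
  rw [indChar, finsum_eq_sum_of_fintype, permChar_eq_sum,
    Subgroup.card_map_of_injective H.subtype_injective]
  simp_rw [inner]
  rw [← Finset.mul_sum, Finset.sum_comm, mul_left_comm]
  congr 1
  rw [inv_mul_eq_iff_eq_mul₀ hH, Nat.card_eq_fintype_card, ← nsmul_eq_mul, ← Finset.card_univ]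
  refine Finset.sum_eq_card_nsmul fun y _ => ?_
  exact Equiv.sum_comp (Equiv.mulRight (y : G))
    (fun z => if z⁻¹ * g * z ∈ K.map H.subtype then (1 : ℂ) else 0)

theorem indChar_sum [Finite G] {ι : Type*} (s : Finset ι) (c : ι → ℂ) (f : ι → H → ℂ) (g : G) :
    indChar H (fun h => ∑ i ∈ s, c i * f i h) g = ∑ i ∈ s, c i * indChar H (f i) g := by
  classical
  have := Fintype.ofFinite G
  simp only [indChar, finsum_eq_sum_of_fintype, Finset.mul_sum]
  rw [Finset.sum_comm]
  refine Finset.sum_congr rfl fun x _ => ?_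
  split_ifs
  · rw [Finset.mul_sum]
    exact Finset.sum_congr rfl fun i _ => by ring
  · simp

theorem indChar_sub [Finite G] (f₁ f₂ : H → ℂ) :
    indChar H (f₁ - f₂) = indChar H f₁ - indChar H f₂ := by
  classical
  have := Fintype.ofFinite G
  funext g
  simp only [indChar, finsum_eq_sum_of_fintype, Pi.sub_apply, ← mul_sub, ← Finset.sum_sub_distrib]
  congr 1
  refine Finset.sum_congr rfl fun x _ => ?_
  split_ifs <;> simp

theorem indChar_one_eq_zero [Finite G] {f : H → ℂ} (hf : f 1 = 0) : indChar H f 1 = 0 := by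
  have hf' : f ⟨1, H.one_mem⟩ = 0 := hf
  simp [indChar, hf']

end Induction

end Chars

/-- If `ρ ∈ S_H` then `Ind_H^G ρ ∈ S_G`. -/
theorem induction_preserves_S (G : Type) [Group G] [Finite G] (H : Subgroup G)
    (ρ : ↥H → ℂ) (hρ : MemS ρ) : MemS (indChar H ρ) := by
  obtain ⟨⟨k, Hs, ns, hperm⟩, hone, V, W, hVW, hdet⟩ := hρ
  refine ⟨⟨k, fun i => (Hs i).map H.subtype, ns, ?_⟩, indChar_one_eq_zero H hone,
    FDRep.of (indRep H V.ρ), FDRep.of (indRep H W.ρ), ?_, detChar_indRep_eq H ?_ hdet⟩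
  · funext g
    simp only [hperm, indChar_sum, indChar_permChar]
  · rw [character_indRep, character_indRep, hVW, indChar_sub]
  · rw [hVW, Pi.sub_apply, FDRep.char_one, FDRep.char_one, sub_eq_zero] at hone
    exact_mod_cast hone
end
end

section
/- Let G be a finite group. If ρ ∈ S_G is a ℤ-linear combination of degree-1 (linear) characters of G, then ρ ∈ P_G. -/
open scoped BigOperators

noncomputable section

open Chars


/-- Coercion of a linear character to a complex valued function. -/
def linChar {G : Type} [Group G] (φ : G →* ℂˣ) : G → ℂ := fun g => (φ g : ℂ)

@[simp]
theorem linChar_apply {G : Type} [Group G] (φ : G →* ℂˣ) (g : G) :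
    linChar φ g = φ g := rfl

theorem linearIndependent_linChar (G : Type) [Group G] :
    LinearIndependent ℤ (linChar : (G →* ℂˣ) → G → ℂ) := by
  have h := (linearIndependent_monoidHom G ℂ).comp
    (fun φ : G →* ℂˣ => (Units.coeHom ℂ).comp φ) (fun φ ψ h => by
      ext g
      exact DFunLike.congr_fun h g)
  exact h.restrict_scalars' ℤ

theorem linearIndependent_units_pow :
    LinearIndependent ℤ (fun (u : ℂˣ) (k : ℕ) => (u : ℂ) ^ k) := by
  have h := (linearIndependent_monoidHom (Multiplicative ℕ) ℂ).comp
    (fun u : ℂˣ => powersHom ℂ (u : ℂ)) (fun u v h => by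
      ext
      simpa using h)
  have h' := h.restrict_scalars' ℤ
  exact h'

theorem exists_basis_eigenvectors {V : Type} [AddCommGroup V] [Module ℂ V]
    [FiniteDimensional ℂ V] (f : Module.End ℂ V) (hf : f.IsSemisimple) :
    ∃ (ι : Type) (_ : Fintype ι) (b : Module.Basis ι ℂ V) (μ : ι → ℂ),
      ∀ i, f (b i) = μ i • b i := by
  classical
  have hint : DirectSum.IsInternal f.eigenspace :=
    (DirectSum.isInternal_submodule_iff_iSupIndep_and_iSup_eq_top _).mpr
      ⟨f.eigenspaces_iSupIndep, hf.iSup_eigenspace_eq_top⟩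
  let b := hint.collectedBasis fun μ => Module.Free.chooseBasis ℂ (f.eigenspace μ)
  exact ⟨_, FiniteDimensional.fintypeBasisIndex b, b, fun i => i.1, fun i =>
    Module.End.mem_eigenspace_iff.mp (hint.collectedBasis_mem _ i)⟩

theorem exists_eigenvalues {V : Type} [AddCommGroup V] [Module ℂ V]
    [FiniteDimensional ℂ V] (f : Module.End ℂ V) {N : ℕ} (hN : N ≠ 0) (hf : f ^ N = 1) :
    ∃ (ι : Type) (_ : Fintype ι) (μ : ι → ℂˣ),
      (∀ k : ℕ, LinearMap.trace ℂ V (f ^ k) = ∑ i, (μ i : ℂ) ^ k) ∧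
        LinearMap.det f = ∏ i, (μ i : ℂ) := by
  classical
  have hss : f.IsSemisimple := by
    refine Module.End.isSemisimple_of_squarefree_aeval_eq_zero
      (p := Polynomial.X ^ N - Polynomial.C 1)
      (Polynomial.separable_X_pow_sub_C 1 (by exact_mod_cast hN) one_ne_zero).squarefree ?_
    simp [hf]
  obtain ⟨ι, _, b, μ, hb⟩ := exists_basis_eigenvectors f hss
  have hpow (k : ℕ) (i : ι) : (f ^ k) (b i) = μ i ^ k • b i := by
    induction k with
    | zero => simp
    | succ k ih => rw [pow_succ', Module.End.mul_apply, ih, map_smul, hb, smul_smul, pow_succ]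
  have hmat (k : ℕ) : LinearMap.toMatrix b b (f ^ k) = Matrix.diagonal fun i => μ i ^ k := by
    ext i j
    rw [LinearMap.toMatrix_apply, hpow]
    rcases eq_or_ne i j with rfl | h
    · simp
    · simp [h]
  have hdet : LinearMap.det f = ∏ i, μ i := by
    have := hmat 1
    simp only [pow_one] at this
    rw [← LinearMap.det_toMatrix b, this, Matrix.det_diagonal]
  have hμ (i : ι) : μ i ≠ 0 := by
    intro h
    have := hpow N i
    rw [hf, h, zero_pow hN, zero_smul] at this
    exact b.ne_zero i this
  refine ⟨ι, inferInstance, fun i => Units.mk0 (μ i) (hμ i), fun k => ?_, by simpa using hdet⟩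
  rw [LinearMap.trace_eq_matrix_trace ℂ b, hmat, Matrix.trace_diagonal]
  simp

/-- A virtual character determines its determinant: if an integral combination of linear
characters has trivial determinant, the corresponding product of linear characters is trivial. -/
theorem prod_zpow_eq_one_of_hasTrivialDet {G : Type} [Group G] [Finite G]
    (n : (G →* ℂˣ) →₀ ℤ)
    (h : HasTrivialDet (Finsupp.linearCombination ℤ linChar n)) :
    n.prod (fun φ m => φ ^ m) = 1 := by
  classical
  obtain ⟨V, W, hVW, hdet⟩ := h
  ext1 g
  have hg (U : FDRep ℂ G) : U.ρ g ^ Nat.card G = 1 := by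
    rw [← map_pow, pow_card_eq_one', map_one]
  obtain ⟨ι, _, μ, htr, hd⟩ := exists_eigenvalues (V.ρ g) Nat.card_pos.ne' (hg V)
  obtain ⟨κ, _, ν, htr', hd'⟩ := exists_eigenvalues (W.ρ g) Nat.card_pos.ne' (hg W)
  let e : ℂˣ →₀ ℤ := n.mapDomain (fun φ => φ g)
  have hev : e = ∑ i, Finsupp.single (μ i) 1 - ∑ i, Finsupp.single (ν i) 1 := by
    refine linearIndependent_units_pow ?_
    ext k
    have hk := congrFun hVW (g ^ k)
    simp only [Pi.sub_apply, FDRep.character, map_pow] at hk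
    rw [htr, htr'] at hk
    simp only [e, Finsupp.linearCombination_mapDomain, map_sub, map_sum,
      Finsupp.linearCombination_single, one_smul, Pi.sub_apply, Finset.sum_apply]
    rw [← hk]
    simp [Finsupp.linearCombination_apply, Finsupp.sum, Finset.sum_apply]
  have hμν : ∏ i, μ i = ∏ i, ν i := by
    ext
    have := hdet g
    simp only [detChar] at this
    rw [hd, hd'] at this
    push_cast
    exact this
  let D : (ℂˣ →₀ ℤ) →ₗ[ℤ] Additive ℂˣ := Finsupp.linearCombination ℤ Additive.ofMul
  have hD : D e = 0 := by
    rw [hev]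
    simp only [D, map_sub, map_sum, Finsupp.linearCombination_single, one_smul, ← ofMul_prod, hμν,
      sub_self]
  have hD' : D e = Additive.ofMul (n.prod (fun φ m => φ ^ m) g) := by
    simp only [D, e, Finsupp.linearCombination_mapDomain]
    simp only [Finsupp.linearCombination_apply, Finsupp.sum,
      Finsupp.prod, MonoidHom.finsetProd_apply, ofMul_prod]
    rfl
  exact Additive.ofMul.injective (hD'.symm.trans hD)

/-- The diagonal representation with the given linear characters. -/
def diagRep {H : Type} [Group H] {k : ℕ} (f : Fin k → (H →* ℂˣ)) : FDRep ℂ H :=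
  FDRep.of (V := Fin k → ℂ)
    { toFun := fun g => Matrix.toLin' (Matrix.diagonal fun i => (f i g : ℂ))
      map_one' := by simp; rfl
      map_mul' := fun g h => by
        rw [Module.End.mul_eq_comp, ← Matrix.toLin'_mul, Matrix.diagonal_mul_diagonal]
        simp }

theorem diagRep_ρ {H : Type} [Group H] {k : ℕ} (f : Fin k → (H →* ℂˣ)) (g : H) :
    (diagRep f).ρ g = Matrix.toLin' (Matrix.diagonal fun i => (f i g : ℂ)) := rfl

theorem character_diagRep {H : Type} [Group H] {k : ℕ} (f : Fin k → (H →* ℂˣ)) :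
    (diagRep f).character = ∑ i, linChar (f i) := by
  ext g
  rw [FDRep.character, diagRep_ρ]
  erw [Matrix.trace_toLin'_eq]
  simp [Matrix.trace_diagonal]

theorem detChar_diagRep {H : Type} [Group H] {k : ℕ} (f : Fin k → (H →* ℂˣ)) :
    detChar (diagRep f) = ∏ i, linChar (f i) := by
  ext g
  rw [detChar, diagRep_ρ]
  erw [LinearMap.det_toLin']
  simp [Matrix.det_diagonal]

/-- `P_G` as an additive subgroup of the functions on `G`. -/
def memPAddSubgroup (G : Type) [Group G] [Finite G] : AddSubgroup (G → ℂ) where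
  carrier := {χ | MemP G χ}
  zero_mem' := MemP.zero
  add_mem' := MemP.add
  neg_mem' := fun {χ} h => by simpa using MemP.zsmul (-1) h

theorem star_linChar {G : Type} [Group G] [Finite G] (φ : G →* ℂˣ) :
    star (linChar φ) = linChar φ⁻¹ := by
  ext g
  have h : ‖(φ g : ℂ)‖ = 1 := by
    refine Complex.norm_eq_one_of_pow_eq_one (n := Nat.card G) ?_ Nat.card_pos.ne'
    rw [← Units.val_pow_eq_pow_val, ← map_pow, pow_card_eq_one', map_one, Units.val_one]
  simp [Complex.inv_eq_conj h]

theorem linChar_one {G : Type} [Group G] : linChar (1 : G →* ℂˣ) = 1 := by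
  ext
  simp

theorem linChar_mul {G : Type} [Group G] (φ ψ : G →* ℂˣ) :
    linChar (φ * ψ) = linChar φ * linChar ψ := by
  ext
  simp

theorem memP_linChar_add_inv {G : Type} [Group G] [Finite G] (φ : G →* ℂˣ) :
    MemP G ((linChar φ - 1) + (linChar φ⁻¹ - 1)) := by
  have h := MemP.selfConj (diagRep ![φ]) (diagRep ![(1 : G →* ℂˣ)])
    (by rw [character_diagRep, character_diagRep]; simp)
  simpa [character_diagRep, linChar_one, star_sub, star_linChar] using h

theorem indChar_top {G : Type} [Group G] [Finite G] (F : G → ℂ)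
    (hF : ∀ x g : G, F (x⁻¹ * g * x) = F g) :
    indChar (⊤ : Subgroup G) (fun h => F h) = F := by
  ext g
  have := Fintype.ofFinite G
  simp [indChar, hF, finsum_eq_sum_of_fintype]

theorem apply_eq_one_or_neg_one {G : Type} [Group G] {φ : G →* ℂˣ} (hφ : φ ^ 2 = 1) (g : G) :
    φ g = 1 ∨ φ g = -1 := by
  have h : φ g ^ 2 = 1 := DFunLike.congr_fun hφ g
  have hc : (φ g : ℂ) ^ 2 = 1 := by rw [← Units.val_pow_eq_pow_val, h, Units.val_one]
  have h' : (φ g : ℂ) = 1 ∨ (φ g : ℂ) = -1 := by simpa using hc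
  exact h'.imp (fun h => Units.ext h) fun h => Units.ext h

theorem exists_apply_eq_neg_one_and_eq_one {H : Type} [Group H] {φ ψ : H →* ℂˣ}
    (hφ : φ ^ 2 = 1) (hψ : ψ ^ 2 = 1) (hφ1 : φ ≠ 1) (hne : φ ≠ ψ) :
    ∃ x, φ x = -1 ∧ ψ x = 1 := by
  obtain ⟨a, ha⟩ := DFunLike.ne_iff.mp hφ1
  obtain ⟨c, hc⟩ := DFunLike.ne_iff.mp hne
  have ha' : φ a = -1 := (apply_eq_one_or_neg_one hφ a).resolve_left ha
  rcases apply_eq_one_or_neg_one hψ a with h | h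
  · exact ⟨a, ha', h⟩
  · rcases apply_eq_one_or_neg_one hφ c with h₁ | h₁ <;>
      rcases apply_eq_one_or_neg_one hψ c with h₂ | h₂
    · exact absurd (h₁.trans h₂.symm) hc
    · exact ⟨a * c, by simp [ha', h₁], by simp [h, h₂]⟩
    · exact ⟨c, h₁, h₂⟩
    · exact absurd (h₁.trans h₂.symm) hc

/-- The joint image of two distinct nontrivial quadratic characters is a Klein four group. -/
theorem isKleinFour_range_prod {H : Type} [Group H] {φ ψ : H →* ℂˣ} (hφ : φ ^ 2 = 1)
    (hψ : ψ ^ 2 = 1) (hφ1 : φ ≠ 1) (hψ1 : ψ ≠ 1) (hne : φ ≠ ψ) :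
    IsKleinFour (φ.prod ψ).range := by
  have hneg : (1 : ℂˣ) ≠ -1 := by
    intro h
    have := congrArg Units.val h
    norm_num at this
  have hset : ((φ.prod ψ).range : Set (ℂˣ × ℂˣ)) = {1, -1} ×ˢ {1, -1} := by
    obtain ⟨a, ha, ha'⟩ := exists_apply_eq_neg_one_and_eq_one hφ hψ hφ1 hne
    obtain ⟨b, hb, hb'⟩ := exists_apply_eq_neg_one_and_eq_one hψ hφ hψ1 hne.symm
    ext ⟨u, v⟩
    simp only [SetLike.mem_coe, MonoidHom.mem_range, MonoidHom.prod_apply, Prod.mk.injEq,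
      Set.mem_prod, Set.mem_insert_iff, Set.mem_singleton_iff]
    constructor
    · rintro ⟨x, rfl, rfl⟩
      exact ⟨apply_eq_one_or_neg_one hφ x, apply_eq_one_or_neg_one hψ x⟩
    · rintro ⟨rfl | rfl, rfl | rfl⟩
      · exact ⟨1, by simp⟩
      · exact ⟨b, hb', hb⟩
      · exact ⟨a, ha, ha'⟩
      · exact ⟨a * b, by simp [ha, hb'], by simp [ha', hb]⟩
  have hcard : Nat.card (φ.prod ψ).range = 4 := by
    rw [← SetLike.coe_sort_coe, hset, Nat.card_coe_set_eq, Set.ncard_prod, Set.ncard_pair hneg]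
  have : Finite (φ.prod ψ).range := Nat.finite_of_card_ne_zero (by omega)
  have : Nontrivial (φ.prod ψ).range := Finite.one_lt_card_iff_nontrivial.mp (by omega)
  refine ⟨hcard, (Monoid.exponent_eq_prime_iff Nat.prime_two).mpr ?_⟩
  rintro ⟨_, x, rfl⟩ hx
  refine orderOf_eq_prime (Subtype.ext ?_) hx
  exact Prod.ext (DFunLike.congr_fun hφ x) (DFunLike.congr_fun hψ x)

theorem memP_linChar_of_ne {G : Type} [Group G] [Finite G] {φ ψ : G →* ℂˣ} (hφ : φ ^ 2 = 1)
    (hψ : ψ ^ 2 = 1) (hφ1 : φ ≠ 1) (hψ1 : ψ ≠ 1) (hne : φ ≠ ψ) :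
    MemP G (linChar φ + linChar ψ - 1 - linChar (φ * ψ)) := by
  let ι : (⊤ : Subgroup G) →* G := Subgroup.subtype ⊤
  have hι {α β : G →* ℂˣ} (h : α.comp ι = β.comp ι) : α = β := by
    ext1 g
    exact DFunLike.congr_fun h ⟨g, trivial⟩
  have hsq {α : G →* ℂˣ} (h : α ^ 2 = 1) : (α.comp ι) ^ 2 = 1 := by
    ext1 g
    exact DFunLike.congr_fun h (ι g)
  have := isKleinFour_range_prod (hsq hφ) (hsq hψ) (fun h => hφ1 (hι h))
    (fun h => hψ1 (hι h)) (fun h => hne (hι h))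
  let N := ((φ.comp ι).prod (ψ.comp ι)).ker
  have hmem := MemP.dihedralInd (⊤ : Subgroup G) (diagRep ![φ.comp ι, ψ.comp ι])
    (by rw [character_diagRep]; norm_num [Fin.sum_univ_two]) N
    (fun n h hn => by
      obtain ⟨h₁, h₂⟩ := Prod.ext_iff.mp (MonoidHom.mem_ker.mp hn)
      simp only [MonoidHom.prod_apply, Prod.fst_one, Prod.snd_one] at h₁ h₂
      simp only [character_diagRep, Fin.sum_univ_two, Pi.add_apply, linChar_apply,
        Matrix.cons_val_zero, Matrix.cons_val_one, map_mul, h₁, h₂, one_mul])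
    (Or.inl ((IsKleinFour.nonempty_mulEquiv (G₂ := Multiplicative (ZMod 2 × ZMod 2))).map
      fun e => (QuotientGroup.quotientKerEquivRange _).trans
        (e.trans (MulEquiv.prodMultiplicative _ _))))
  rw [character_diagRep, detChar_diagRep] at hmem
  rw [← indChar_top (linChar φ + linChar ψ - 1 - linChar (φ * ψ))
    (fun x g => by simp [mul_comm])]
  convert hmem using 2
  ext h
  simp [Fin.sum_univ_two, Fin.prod_univ_two, ι]

theorem memP_linChar_mul {G : Type} [Group G] [Finite G] {φ ψ : G →* ℂˣ} (hφ : φ ^ 2 = 1)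
    (hψ : ψ ^ 2 = 1) :
    MemP G (linChar φ + linChar ψ - 1 - linChar (φ * ψ)) := by
  rcases eq_or_ne φ 1 with rfl | hφ1
  · simpa [linChar_mul, linChar_one] using MemP.zero (G := G)
  rcases eq_or_ne ψ 1 with rfl | hψ1
  · simpa [linChar_mul, linChar_one] using MemP.zero (G := G)
  rcases eq_or_ne φ ψ with rfl | hne
  · have h := memP_linChar_add_inv φ
    have hφφ : φ * φ = 1 := (sq φ).symm.trans hφ
    have hinv : φ⁻¹ = φ := by
      ext1 g
      exact inv_eq_of_mul_eq_one_left (DFunLike.congr_fun hφφ g)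
    rw [hinv] at h
    rw [hφφ, linChar_one]
    convert h using 1
    ring
  · exact memP_linChar_of_ne hφ hψ hφ1 hψ1 hne

/-- The class of `φ - 1` modulo `P_G`. -/
def linCharClass {G : Type} [Group G] [Finite G] (φ : G →* ℂˣ) :
    (G → ℂ) ⧸ memPAddSubgroup G :=
  QuotientAddGroup.mk (linChar φ - 1)

theorem linCharClass_add_inv {G : Type} [Group G] [Finite G] (φ : G →* ℂˣ) :
    linCharClass φ + linCharClass φ⁻¹ = 0 :=
  (QuotientAddGroup.eq_zero_iff _).mpr (memP_linChar_add_inv φ)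

theorem linCharClass_mul {G : Type} [Group G] [Finite G] {φ ψ : G →* ℂˣ} (hφ : φ ^ 2 = 1)
    (hψ : ψ ^ 2 = 1) : linCharClass (φ * ψ) = linCharClass φ + linCharClass ψ := by
  have h := (QuotientAddGroup.eq_zero_iff (N := memPAddSubgroup G) _).mpr (memP_linChar_mul hφ hψ)
  symm
  rw [← sub_eq_zero, ← h]
  simp only [linCharClass, ← QuotientAddGroup.mk_add, ← QuotientAddGroup.mk_sub]
  congr 1
  ring

section QuadraticAdditive

variable {X A : Type} [CommGroup X] [AddCommGroup A] {F : X → A}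

theorem sum_zsmul_of_sq_eq_one (hF : ∀ x y, x ^ 2 = 1 → y ^ 2 = 1 → F (x * y) = F x + F y)
    (s : Finset X) (n : X → ℤ) (hs : ∀ x ∈ s, x ^ 2 = 1) (hprod : ∏ x ∈ s, x ^ n x = 1) :
    ∑ x ∈ s, n x • F x = 0 := by
  let K := (powMonoidHom 2 : X →* X).ker
  let f : K →* Multiplicative A :=
    MonoidHom.mk' (fun x => Multiplicative.ofAdd (F x)) fun x y =>
      congrArg Multiplicative.ofAdd (hF x y (MonoidHom.mem_ker.mp x.2) (MonoidHom.mem_ker.mp y.2))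
  have hK : ∏ x : s, (⟨x.1, hs x x.2⟩ : K) ^ n x = 1 := by
    ext1
    rw [Subgroup.val_finsetProd]
    exact (Finset.prod_coe_sort s fun x => x ^ n x).trans hprod
  have h := congrArg f hK
  simp_rw [map_prod, map_zpow, map_one] at h
  rw [← Finset.sum_coe_sort]
  simpa [f, ← ofAdd_zsmul, ← ofAdd_sum] using h

/-- If `F` is odd and is additive on elements of order dividing `2`, then it kills every
inversion invariant integral combination of elements with trivial product. -/
theorem sum_zsmul_eq_zero_of_prod_eq_one
    (hF : ∀ x y, x ^ 2 = 1 → y ^ 2 = 1 → F (x * y) = F x + F y)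
    (hFinv : ∀ x, F x + F x⁻¹ = 0) (n : X →₀ ℤ) (hinv : ∀ x, n x⁻¹ = n x)
    (hprod : n.prod (fun x m => x ^ m) = 1) :
    n.sum (fun x m => m • F x) = 0 := by
  classical
  have hne {x : X} (h : ¬ x ^ 2 = 1) : x⁻¹ ≠ x := fun h' =>
    h (by rw [sq]; nth_rw 1 [← h']; exact inv_mul_cancel x)
  have hmem {x : X} (h : x ∈ n.support.filter fun x => ¬ x ^ 2 = 1) :
      x⁻¹ ∈ n.support.filter fun x => ¬ x ^ 2 = 1 := by
    simpa [hinv] using h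
  have hsum : ∑ x ∈ n.support with ¬ x ^ 2 = 1, n x • F x = 0 :=
    Finset.sum_involution (fun x _ => x⁻¹)
      (fun x _ => by rw [hinv, ← smul_add, hFinv, smul_zero])
      (fun x hx _ => hne (Finset.mem_filter.mp hx).2) (fun x hx => hmem hx)
      (fun x _ => inv_inv x)
  have hprod' : ∏ x ∈ n.support with ¬ x ^ 2 = 1, x ^ n x = 1 :=
    Finset.prod_involution (fun x _ => x⁻¹)
      (fun x _ => by rw [hinv, ← mul_zpow, mul_inv_cancel, one_zpow])
      (fun x hx _ => hne (Finset.mem_filter.mp hx).2) (fun x hx => hmem hx)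
      (fun x _ => inv_inv x)
  rw [Finsupp.prod, ← Finset.prod_filter_mul_prod_filter_not _ fun x => x ^ 2 = 1, hprod',
    mul_one] at hprod
  rw [Finsupp.sum, ← Finset.sum_filter_add_sum_filter_not _ fun x => x ^ 2 = 1, hsum, add_zero]
  exact sum_zsmul_of_sq_eq_one hF _ _ (fun x hx => (Finset.mem_filter.mp hx).2) hprod

end QuadraticAdditive

theorem apply_inv_eq_of_star_eq {G : Type} [Group G] [Finite G] (n : (G →* ℂˣ) →₀ ℤ)
    (h : star (Finsupp.linearCombination ℤ linChar n) = Finsupp.linearCombination ℤ linChar n)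
    (φ : G →* ℂˣ) : n φ⁻¹ = n φ := by
  have hmap : n.mapDomain (fun φ => φ⁻¹) = n := by
    apply linearIndependent_linChar G
    rw [← h, Finsupp.linearCombination_mapDomain]
    simp [Finsupp.linearCombination_apply, Finsupp.sum, star_sum, star_linChar]
  conv_lhs => rw [← hmap]
  exact Finsupp.mapDomain_apply inv_injective n φ

theorem star_eq_of_isPermChar {G : Type} [Group G] {χ : G → ℂ} (h : IsPermChar χ) :
    star χ = χ := by
  obtain ⟨k, Hs, ns, rfl⟩ := h
  ext g
  simp [permChar]

theorem exists_linearCombination_linChar {G : Type} [Group G] {χ : G → ℂ}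
    (hlin : ∃ (k : ℕ) (fs : Fin k → (G →* ℂ)) (ns : Fin k → ℤ),
      χ = fun g => ∑ i, (ns i : ℂ) * fs i g) :
    ∃ n : (G →* ℂˣ) →₀ ℤ, χ = Finsupp.linearCombination ℤ linChar n := by
  obtain ⟨k, fs, ns, rfl⟩ := hlin
  refine ⟨∑ i, Finsupp.single (fs i).toHomUnits (ns i), ?_⟩
  ext g
  simp [map_sum, Finset.sum_apply, Finsupp.linearCombination_single]

/-- If `χ ∈ S_G` is a `ℤ`-linear combination of degree `1` (linear)
characters of `G`, then `χ ∈ P_G`. -/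
theorem memS_linear_combination_of_linear_chars_memP
    (G : Type) [Group G] [Finite G] (χ : G → ℂ) (hχ : MemS χ)
    (hlin : ∃ (k : ℕ) (fs : Fin k → (G →* ℂ)) (ns : Fin k → ℤ),
      χ = fun g => ∑ i, (ns i : ℂ) * fs i g) :
    MemP G χ := by
  obtain ⟨hperm, hdeg, hdet⟩ := hχ
  obtain ⟨n, rfl⟩ := exists_linearCombination_linChar hlin
  have hsum := sum_zsmul_eq_zero_of_prod_eq_one (fun _ _ => linCharClass_mul)
    linCharClass_add_inv n (apply_inv_eq_of_star_eq n (star_eq_of_isPermChar hperm))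
    (prod_zpow_eq_one_of_hasTrivialDet n hdet)
  have hn : n.sum (fun _ m => m) = 0 := by
    simp only [Finsupp.linearCombination_apply, Finsupp.sum, Finset.sum_apply,
      Pi.smul_apply] at hdeg
    simp only [linChar_apply, map_one, Units.val_one, zsmul_eq_mul, mul_one] at hdeg
    exact_mod_cast hdeg
  refine (QuotientAddGroup.eq_zero_iff (N := memPAddSubgroup G) _).mp ?_
  rw [← hsum]
  have hχ : Finsupp.linearCombination ℤ linChar n =
      n.sum fun φ m => m • (linChar φ - 1 : G → ℂ) := by
    simp only [Finsupp.linearCombination_apply, Finsupp.sum, smul_sub, Finset.sum_sub_distrib,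
      ← Finset.sum_smul] at hn ⊢
    rw [hn, zero_smul, sub_zero]
  rw [hχ]
  exact map_finsuppSum (QuotientAddGroup.mk' (memPAddSubgroup G)) n _
end
end

section
/- Let G be a finite group of odd order. Then S_G ⊆ P_G. -/
open scoped BigOperators

noncomputable section

open Chars

/-- In a group of odd order, an element swapping two points fixes them. -/
theorem eq_of_smul_eq_of_smul_eq {G X : Type*} [Group G] [MulAction G X]
    (hodd : Odd (Nat.card G)) {g : G} {x y : X} (hxy : g • x = y) (hyx : g • y = x) : x = y := by
  obtain ⟨k, hk⟩ := hodd
  have hsq : g ^ 2 ∈ MulAction.stabilizer G x := by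
    rw [MulAction.mem_stabilizer_iff, pow_two, mul_smul, hxy, hyx]
  have hg : g ∈ MulAction.stabilizer G x := by
    have h1 : (g ^ 2) ^ (k + 1) = g := by
      rw [← pow_mul, show 2 * (k + 1) = Nat.card G + 1 by omega, pow_succ, pow_card_eq_one',
        one_mul]
    rw [← h1]
    exact pow_mem hsq _
  rw [← hxy]
  exact (MulAction.mem_stabilizer_iff.1 hg).symm

/-- A set with an action of a group of odd order carries an invariant tournament, encoded by a
skew-symmetric sign function. -/
theorem exists_invariant_tournament (G X : Type*) [Group G] [MulAction G X]
    (hodd : Odd (Nat.card G)) :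
    ∃ s : X → X → ℤ, (∀ x y, s y x = -s x y) ∧ (∀ x y, x ≠ y → Odd (s x y)) ∧
      ∀ (g : G) x y, s (g • x) (g • y) = s x y := by
  classical
  let orb : X → X → MulAction.orbitRel.Quotient G (X × X) := fun x y => Quotient.mk'' (x, y)
  let : LinearOrder (MulAction.orbitRel.Quotient G (X × X)) := linearOrderOfSTO WellOrderingRel
  have horb : ∀ (g : G) x y, orb (g • x) (g • y) = orb x y := fun g x y =>
    Quotient.sound (MulAction.orbitRel_apply.2 ⟨g, rfl⟩)
  have hne : ∀ x y, x ≠ y → orb x y ≠ orb y x := by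
    intro x y hxy h
    obtain ⟨g, hg⟩ := MulAction.orbitRel_apply.1 (Quotient.exact h)
    obtain ⟨h1, h2⟩ := Prod.ext_iff.1 hg
    exact hxy (eq_of_smul_eq_of_smul_eq hodd h2 h1)
  refine ⟨fun x y => if orb x y < orb y x then 1 else if orb y x < orb x y then -1 else 0,
    fun x y => ?_, fun x y hxy => ?_, fun g x y => by simp only [horb]⟩
  · rcases lt_trichotomy (orb x y) (orb y x) with h | h | h
    · simp [h, h.not_gt]
    · simp [h]
    · simp [h, h.not_gt]
  · rcases lt_or_gt_of_ne (hne x y hxy) with h | h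
    · simp [h]
    · simp [h, h.not_gt]

section Matrices

variable {G X : Type} [Group G] [Fintype X] [DecidableEq X]

/-- An idempotent commuting with a matrix representation cuts out a subrepresentation. -/
theorem exists_fdRep_character_eq_trace_mul (Q : G →* Matrix X X ℂ) {P : Matrix X X ℂ}
    (hP : IsIdempotentElem P) (hcomm : ∀ g, Commute P (Q g)) :
    ∃ V : FDRep ℂ G, ∀ g, V.character g = (Q g * P).trace := by
  let U : Submodule ℂ (X → ℂ) := LinearMap.range (Matrix.toLin' P)
  have hU : ∀ g, ∀ v ∈ U, Matrix.toLin' (Q g) v ∈ U := by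
    rintro g _ ⟨w, rfl⟩
    refine ⟨Matrix.toLin' (Q g) w, ?_⟩
    rw [← LinearMap.comp_apply, ← LinearMap.comp_apply, ← Matrix.toLin'_mul, ← Matrix.toLin'_mul,
      (hcomm g).eq]
  have hid : ∀ v ∈ U, Matrix.toLin' P v = v := by
    rintro _ ⟨w, rfl⟩
    rw [← LinearMap.comp_apply, ← Matrix.toLin'_mul, hP.eq]
  let ρ : Representation ℂ G U :=
    { toFun := fun g => (Matrix.toLin' (Q g)).restrict (hU g)
      map_one' := by ext v; simp
      map_mul' := fun g h => by ext v; simp }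
  refine ⟨FDRep.of ρ, fun g => ?_⟩
  have hmem : ∀ v, Matrix.toLin' (Q g * P) v ∈ U := fun v => by
    rw [Matrix.toLin'_mul]
    exact hU g _ ⟨v, rfl⟩
  have hres : ρ g = (Matrix.toLin' (Q g * P)).restrict fun v _ => hmem v := by
    refine LinearMap.ext fun v => Subtype.ext ?_
    change Matrix.toLin' (Q g) v = Matrix.toLin' (Q g * P) v
    rw [Matrix.toLin'_mul, LinearMap.comp_apply, hid v v.2]
  change LinearMap.trace ℂ U (ρ g) = _
  rw [hres, LinearMap.trace_restrict_eq_of_forall_mem _ _ hmem, Matrix.trace_toLin'_eq]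

variable [MulAction G X]

/-- The matrix representation attached to an action on a finite set. -/
def permRepMatrix (G X : Type) [Group G] [MulAction G X] [Fintype X] [DecidableEq X] :
    G →* Matrix X X ℂ where
  toFun g := Matrix.of fun x y => if x = g • y then 1 else 0
  map_one' := by ext x y; simp [Matrix.one_apply]
  map_mul' g h := by ext x y; simp [Matrix.mul_apply, mul_smul]

theorem permRepMatrix_apply (g : G) (x y : X) :
    permRepMatrix G X g x y = if x = g • y then 1 else 0 := rfl

theorem permRepMatrix_mul_apply (g : G) (B : Matrix X X ℂ) (x y : X) :
    (permRepMatrix G X g * B) x y = B (g⁻¹ • x) y := by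
  simp [Matrix.mul_apply, permRepMatrix_apply, ← inv_smul_eq_iff]

theorem mul_permRepMatrix_apply (g : G) (B : Matrix X X ℂ) (x y : X) :
    (B * permRepMatrix G X g) x y = B x (g • y) := by
  simp [Matrix.mul_apply, permRepMatrix_apply]

theorem trace_permRepMatrix (g : G) :
    (permRepMatrix G X g).trace = (Nat.card {x : X // g • x = x} : ℂ) := by
  simp [Matrix.trace, permRepMatrix_apply, Fintype.card_subtype, eq_comm]

theorem continuousOn_spectrum (A : Matrix X X ℂ) (f : ℝ → ℝ) : ContinuousOn f (spectrum ℝ A) :=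
  Matrix.finite_real_spectrum.continuousOn f

/-- Entrywise complex conjugation. -/
def conjStarAlgHom (X : Type) [Fintype X] [DecidableEq X] :
    Matrix X X ℂ →⋆ₐ[ℝ] Matrix X X ℂ where
  toAlgHom := AlgHom.mapMatrix Complex.conjAe.toAlgHom
  map_star' B := by ext x y; simp [Matrix.star_apply]

theorem conjStarAlgHom_apply (B : Matrix X X ℂ) (x y : X) :
    conjStarAlgHom X B x y = star (B x y) := rfl

theorem trace_conjStarAlgHom (B : Matrix X X ℂ) :
    (conjStarAlgHom X B).trace = star B.trace := by
  simp [Matrix.trace, conjStarAlgHom_apply]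

theorem continuous_conjStarAlgHom : Continuous (conjStarAlgHom X) := by
  refine continuous_pi fun x => continuous_pi fun y => ?_
  exact continuous_star.comp ((continuous_apply y).comp (continuous_apply x))

theorem conjStarAlgHom_permRepMatrix (g : G) :
    conjStarAlgHom X (permRepMatrix G X g) = permRepMatrix G X g := by
  ext x y
  rw [conjStarAlgHom_apply, permRepMatrix_apply]
  split_ifs <;> simp

/-- If `s` is a tournament then `s` and the all-ones matrix have no common kernel. -/
theorem eq_zero_of_tournament_mul_eq_zero {s : X → X → ℤ} (hskew : ∀ x y, s y x = -s x y)
    (hs : ∀ x y, x ≠ y → Odd (s x y)) {B : Matrix X X ℂ}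
    (hB : (Matrix.of fun x y => (s x y : ℂ)) * B = 0) (hsum : ∀ y, ∑ x, B x y = 0) : B = 0 := by
  let M : Matrix X X ℤ := Matrix.of fun x y => s x y + 1
  have hM2 : (Int.castRingHom (ZMod 2)).mapMatrix M = 1 := by
    ext x y
    rcases eq_or_ne x y with rfl | hxy
    · have : s x x = 0 := by have := hskew x x; omega
      simp [M, this]
    · simp only [M, RingHom.mapMatrix_apply, Matrix.map_apply, Matrix.of_apply,
        Matrix.one_apply_ne hxy, eq_intCast]
      exact (ZMod.intCast_zmod_eq_zero_iff_dvd _ 2).2 (hs x y hxy).add_one.two_dvd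
  have hdet : M.det ≠ 0 := by
    intro h
    have h1 := RingHom.map_det (Int.castRingHom (ZMod 2)) M
    rw [hM2, h, Matrix.det_one, map_zero] at h1
    exact zero_ne_one h1
  have hdetC : IsUnit ((Int.castRingHom ℂ).mapMatrix M).det := by
    rw [← RingHom.map_det, isUnit_iff_ne_zero]
    simpa using hdet
  have hMB : (Int.castRingHom ℂ).mapMatrix M * B = 0 := by
    ext x y
    have h1 := congrFun (congrFun hB x) y
    simp only [Matrix.mul_apply, Matrix.of_apply, Matrix.zero_apply] at h1
    simp [Matrix.mul_apply, M, add_mul, Finset.sum_add_distrib, h1, hsum]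
  rw [← Matrix.nonsing_inv_mul_cancel_left _ B hdetC, hMB, Matrix.mul_zero]

/-- For a group of odd order, the character of a permutation representation is the sum of a
constant, a character and its complex conjugate. -/
theorem exists_fdRep_card_fixed_eq (hodd : Odd (Nat.card G)) :
    ∃ (V : FDRep ℂ G) (c : ℂ), ∀ g : G,
      (Nat.card {x : X // g • x = x} : ℂ) = V.character g + star (V.character g) + c := by
  obtain ⟨s, hskew, hs, hinv⟩ := exists_invariant_tournament G X hodd
  let S : Matrix X X ℂ := Matrix.of fun x y => (s x y : ℂ)
  let A : Matrix X X ℂ := Complex.I • S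
  let Q := permRepMatrix G X
  have hA : IsSelfAdjoint A := by
    ext x y
    simp [A, S, Matrix.star_apply, hskew x y]
  have hconjA : conjStarAlgHom X A = -A := by
    ext x y
    simp [conjStarAlgHom_apply, A, S]
  have hcomm : ∀ g, Commute A (Q g) := fun g => by
    ext x y
    rw [mul_permRepMatrix_apply, permRepMatrix_mul_apply]
    have := hinv g (g⁻¹ • x) y
    rw [smul_inv_smul] at this
    simp [A, S, this]
  let pos : ℝ → ℝ := fun t => if 0 < t then 1 else 0
  let nul : ℝ → ℝ := fun t => if t = 0 then 1 else 0
  let P := cfc pos A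
  let P₀ := cfc nul A
  have hcont : ∀ f : ℝ → ℝ, ContinuousOn f (spectrum ℝ A) := continuousOn_spectrum A
  have hP : IsIdempotentElem P := by
    change cfc pos A * cfc pos A = cfc pos A
    rw [← cfc_mul pos pos A (hcont _) (hcont _)]
    congr 1
    ext t
    by_cases h : 0 < t <;> simp [pos, h]
  have hconjP : conjStarAlgHom X P = cfc (fun t => pos (-t)) A := by
    change conjStarAlgHom X (cfc pos A) = _
    rw [StarAlgHom.map_cfc (conjStarAlgHom X) pos A (hcont _) continuous_conjStarAlgHom hA
      (by rw [hconjA]; exact hA.neg), hconjA]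
    exact (cfc_comp_neg pos A (Matrix.finite_real_spectrum.image _ |>.continuousOn _) hA).symm
  have hsum : P + conjStarAlgHom X P + P₀ = 1 := by
    rw [hconjP, ← cfc_add A pos _ (hcont _) (hcont _), ← cfc_add A _ nul (hcont _) (hcont _),
      ← cfc_const_one ℝ A hA]
    congr 1
    ext t
    rcases lt_trichotomy t 0 with h | h | h
    · simp [pos, nul, h, h.not_gt, h.ne]
    · simp [pos, nul, h]
    · simp [pos, nul, h, h.not_gt, h.ne']
  have hSP₀ : S * P₀ = 0 := by
    have h1 : A * P₀ = 0 := by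
      change A * cfc nul A = 0
      nth_rewrite 1 [← cfc_id ℝ A hA]
      rw [← cfc_mul id nul A (hcont _) (hcont _), ← cfc_const_zero ℝ A]
      congr 1
      ext t
      by_cases h : t = 0 <;> simp [nul, h]
    rw [Matrix.smul_mul] at h1
    exact (smul_eq_zero.1 h1).resolve_left Complex.I_ne_zero
  have hQP₀ : ∀ g, Q g * P₀ = P₀ := fun g => by
    refine sub_eq_zero.1 (eq_zero_of_tournament_mul_eq_zero hskew hs ?_ fun y => ?_)
    · have h1 : S * Q g = Q g * S := by
        have := (hcomm g).eq
        rw [Matrix.smul_mul, Matrix.mul_smul] at this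
        exact smul_right_injective _ Complex.I_ne_zero this
      change S * (Q g * P₀ - P₀) = 0
      rw [Matrix.mul_sub, ← Matrix.mul_assoc, h1, Matrix.mul_assoc, hSP₀, Matrix.mul_zero, sub_zero]
    · simp only [Matrix.sub_apply, Finset.sum_sub_distrib, Q, permRepMatrix_mul_apply]
      rw [sub_eq_zero]
      exact Equiv.sum_comp (MulAction.toPerm g⁻¹) fun x => P₀ x y
  obtain ⟨V, hV⟩ := exists_fdRep_character_eq_trace_mul Q hP fun g => (hcomm g).cfc_real pos
  refine ⟨V, P₀.trace, fun g => ?_⟩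
  rw [hV, ← trace_conjStarAlgHom, map_mul, conjStarAlgHom_permRepMatrix, ← trace_permRepMatrix]
  rw [show P₀.trace = (Q g * P₀).trace by rw [hQP₀], ← Matrix.trace_add, ← Matrix.trace_add, ← Matrix.mul_add, ← Matrix.mul_add, hsum,
    Matrix.mul_one]

end Matrices

/-- For a group of odd order, a permutation character minus its degree lies in `P_G`. -/
theorem memP_permChar_sub_degree {G : Type} [Group G] [Finite G] (hodd : Odd (Nat.card G))
    (H : Subgroup G) : MemP G fun g => permChar H g - permChar H 1 := by
  classical
  let := Fintype.ofFinite (G ⧸ H)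
  obtain ⟨V, c, hV⟩ := exists_fdRep_card_fixed_eq (X := G ⧸ H) hodd
  let W : FDRep ℂ G := FDRep.of (Representation.trivial ℂ G V)
  have hW : ∀ g, W.character g = V.character 1 := fun g => by
    rw [FDRep.char_one]
    exact LinearMap.trace_one ℂ V
  convert MemP.selfConj V W (hW 1).symm using 1
  ext g
  simp only [permChar, hV, Pi.add_apply, Pi.sub_apply, Pi.star_apply, hW, star_sub]
  ring

theorem memP_sum {G : Type} [Group G] [Finite G] {ι : Type*} (t : Finset ι) {f : ι → G → ℂ}
    (hf : ∀ i ∈ t, MemP G (f i)) : MemP G (∑ i ∈ t, f i) :=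
  Finset.sum_induction f (MemP G) (fun _ _ => MemP.add) MemP.zero hf

/-- If `G` has odd order then `S_G ⊆ P_G`. -/
theorem odd_order_S_subset_P (G : Type) [Group G] [Finite G]
    (hodd : Odd (Nat.card G)) :
    ∀ χ : G → ℂ, MemS χ → MemP G χ := by
  rintro χ ⟨⟨k, Hs, ns, rfl⟩, hdeg, -⟩
  convert memP_sum Finset.univ fun i _ =>
    (memP_permChar_sub_degree hodd (Hs i)).zsmul (ns i) using 1
  ext g
  beta_reduce at hdeg
  simp only [Finset.sum_apply, zsmul_eq_mul, Pi.mul_apply, Pi.intCast_apply,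
    mul_sub, Finset.sum_sub_distrib, hdeg, sub_zero]
end
end
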